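/- arXiv:2211.03829 — 2 statements merged into one kernel-verified Lean document; each statement's English description precedes it below -/
import Mathlib

section
/- Let N ≥ 1 be an integer, let z > 0, v_d > 0, γ ∈ (0,1), D > 0, t_1 ∈ ℝ, C ∈ ℝ. For k ∈ {1,…,N+1} define J_k = t_1 + (k−1)·z/v_d + C + D·(Σ_{i=k}^{N} γ^{i−k}) (empty sum = 0 for k = N+1). Then for q ∈ {1,…,N+1}, q is a minimizer of J_k over {1,…,N+1} (i.e. J_q ≤ J_k for all k) if and only if: (a) whenever q ≤ N, ((1−γ^{N−q+1})/((1−γ)(N−q+1)))·v_d·D ≤ z, and (b) whenever q ≥ 2, z ≤ (γ^{N−q+1}(1−γ^{q−1})/((1−γ)(q−1)))·v_d·D. -/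
/-- A sequence with antitone increments is bounded below by its endpoint values. -/
lemma end_min (γ D w : ℝ) (h0 : 0 < γ) (h1 : γ < 1) (hD : 0 < D) (N m : ℕ) (hm : m ≤ N) :
    (0 : ℝ) ≤ D * ∑ i ∈ Finset.range m, γ ^ i - m * w ∨
    D * ∑ i ∈ Finset.range N, γ ^ i - N * w ≤ D * ∑ i ∈ Finset.range m, γ ^ i - m * w := by
  rcases le_total w (D * γ ^ m) with h | h
  · left
    have : ∀ j ≤ m, (0 : ℝ) ≤ D * ∑ i ∈ Finset.range j, γ ^ i - j * w := by
      intro j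
      induction j with
      | zero => simp
      | succ j ih =>
        intro hj
        have h2 := ih (by omega)
        have h3 : γ ^ m ≤ γ ^ j := pow_le_pow_of_le_one h0.le h1.le (by omega)
        have h4 := mul_le_mul_of_nonneg_left h3 hD.le
        rw [Finset.sum_range_succ]
        push_cast
        linarith
    exact this m le_rfl
  · right
    induction N, hm using Nat.le_induction with
    | base => exact le_rfl
    | succ j hj ih =>
      have h3 : γ ^ j ≤ γ ^ m := pow_le_pow_of_le_one h0.le h1.le hj
      have h4 := mul_le_mul_of_nonneg_left h3 hD.le
      rw [Finset.sum_range_succ]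
      push_cast
      linarith

/-- Theorem 1(ii), time-optimal case with positive disruption `D > 0`:
`q` minimizes `J k` over `{1, …, N+1}` iff the inter-HDV distance `z` satisfies
the lower bound (when `q ≤ N`) and the upper bound (when `q ≥ 2`). -/
theorem stmt_1 (N : ℕ) (hN : 1 ≤ N) (z vd γ D t1 C : ℝ)
    (hz : 0 < z) (hvd : 0 < vd) (hγ : γ ∈ Set.Ioo (0 : ℝ) 1) (hD : 0 < D)
    (q : ℕ) (hq1 : 1 ≤ q) (hqN : q ≤ N + 1) :
    let J : ℕ → ℝ := fun k =>
      t1 + ((k : ℝ) - 1) * z / vd + C + D * ∑ i ∈ Finset.Icc k N, γ ^ (i - k)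
    ((∀ k : ℕ, 1 ≤ k → k ≤ N + 1 → J q ≤ J k) ↔
      ((q ≤ N →
          (1 - γ ^ (N + 1 - q)) / ((1 - γ) * ((N : ℝ) - q + 1)) * vd * D ≤ z) ∧
       (2 ≤ q →
          z ≤ γ ^ (N + 1 - q) * (1 - γ ^ (q - 1)) / ((1 - γ) * ((q : ℝ) - 1)) * vd * D))) := by
  intro J
  obtain ⟨h0, h1⟩ := hγ
  have hg : 0 < 1 - γ := by linarith
  have hJ : ∀ k : ℕ, k ≤ N + 1 → J k = (t1 + C + N * (z / vd)) +
      (D * ∑ i ∈ Finset.range (N + 1 - k), γ ^ i - ((N + 1 - k : ℕ) : ℝ) * (z / vd)) := by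
    intro k hk
    have hs : ∑ i ∈ Finset.Icc k N, γ ^ (i - k) = ∑ i ∈ Finset.range (N + 1 - k), γ ^ i := by
      rw [show Finset.Icc k N = Finset.Ico k (N + 1) by ext; simp,
        Finset.sum_Ico_eq_sum_range]
      simp
    simp only [J]
    rw [hs, Nat.cast_sub hk]
    push_cast
    ring
  have hS : ∀ n : ℕ, ∑ i ∈ Finset.range n, γ ^ i = (1 - γ ^ n) / (1 - γ) := by
    intro n
    rw [eq_div_iff hg.ne']
    linarith [geom_sum_mul γ n]
  have hA : (q ≤ N →
      (1 - γ ^ (N + 1 - q)) / ((1 - γ) * ((N : ℝ) - q + 1)) * vd * D ≤ z) ↔ J q ≤ J (N + 1) := by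
    rcases Nat.lt_or_ge N q with h | h
    · have : q = N + 1 := by omega
      subst this
      simp
    · have hp : (0 : ℝ) < (N : ℝ) - q + 1 := by
        have : (q : ℝ) ≤ N := by exact_mod_cast h
        linarith
      rw [hJ q hqN, hJ (N + 1) le_rfl, hS, Nat.cast_sub hqN]
      simp only [h, true_imp_iff, Nat.sub_self, Finset.range_zero, Finset.sum_empty]
      push_cast
      have e : (1 - γ ^ (N + 1 - q)) / ((1 - γ) * ((N : ℝ) - q + 1)) * vd * D
          = (D * ((1 - γ ^ (N + 1 - q)) / (1 - γ))) * vd / ((N : ℝ) - q + 1) := by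
        field_simp
      have e2 : ((N : ℝ) + 1 - q) * (z / vd) = (z * ((N : ℝ) - q + 1)) / vd := by ring
      rw [e, e2, div_le_iff₀ hp, ← le_div_iff₀ hvd]
      constructor <;> intro h <;> linarith
  have hB : (2 ≤ q →
      z ≤ γ ^ (N + 1 - q) * (1 - γ ^ (q - 1)) / ((1 - γ) * ((q : ℝ) - 1)) * vd * D) ↔
      J q ≤ J 1 := by
    rcases Nat.lt_or_ge q 2 with h | h
    · have : q = 1 := by omega
      subst this
      simp
    · have hp : (0 : ℝ) < (q : ℝ) - 1 := by
        have : (2 : ℝ) ≤ q := by exact_mod_cast h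
        linarith
      rw [hJ q hqN, hJ 1 (by omega), hS, hS, Nat.cast_sub hqN]
      simp only [h, true_imp_iff, Nat.add_sub_cancel]
      push_cast
      have hpow : γ ^ N = γ ^ (N + 1 - q) * γ ^ (q - 1) := by
        rw [← pow_add]
        congr 1
        omega
      have e : γ ^ (N + 1 - q) * (1 - γ ^ (q - 1)) / ((1 - γ) * ((q : ℝ) - 1)) * vd * D
          = (D * ((1 - γ ^ N) / (1 - γ)) - D * ((1 - γ ^ (N + 1 - q)) / (1 - γ))) * vd
            / ((q : ℝ) - 1) := by
        rw [hpow]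
        field_simp
        ring
      have e2 : ((N : ℝ) + 1 - q) * (z / vd) = N * (z / vd) - (z * ((q : ℝ) - 1)) / vd := by ring
      rw [e, e2, le_div_iff₀ hp, ← div_le_iff₀ hvd]
      constructor <;> intro h <;> linarith
  rw [hA, hB]
  constructor
  · intro h
    exact ⟨h _ (by omega) le_rfl, h _ le_rfl (by omega)⟩
  · rintro ⟨ha, hb⟩ k hk1 hk2
    have hN1 := hJ (N + 1) le_rfl
    have h11 := hJ 1 (by omega)
    have hk := hJ k hk2
    simp only [Nat.sub_self, Finset.range_zero, Finset.sum_empty, Nat.cast_zero] at hN1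
    simp only [Nat.add_sub_cancel] at h11
    rcases end_min γ D (z / vd) h0 h1 hD N (N + 1 - k) (by omega) with h | h
    · linarith
    · linarith
end

section
/- Let N ≥ 1 be an integer, γ ∈ (0,1), D ≥ 0, and let A₁ > 0, A₂ < 0, A₃ > 0 be reals with A₂² ≥ 3·A₁·A₃; set τ₁ = (−A₂ − √(A₂² − 3·A₁·A₃))/A₁ and E(t) = (A₁t² + A₂t + A₃)/t³. Let t₁ < t₂ < … < t_{N+1} be positive reals with t_{N+1} ≤ τ₁. Define J₁ = E(t₁) and, for 2 ≤ k ≤ N+1, J_k = E(t_k) + D·Σ_{i=k}^{N} γ^{i−k} (empty sum = 0 for k = N+1). Then min_{1 ≤ k ≤ N+1} J_k = min(J₁, J_{N+1}). -/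
/-- Theorem 2 (energy-optimal merging sequence, `α = 0`): with travel times
`t 1 < t 2 < … < t (N+1)` all positive and `t (N+1) ≤ τ₁`, the minimum of
`J k` over `k ∈ {1, …, N+1}` is `min (J 1) (J (N+1))`, where `J 1 = E (t 1)`
and `J k = E (t k) + D ∑_{i=k}^{N} γ^(i-k)` for `k ≥ 2`. -/
theorem stmt_8 (N : ℕ) (hN : 1 ≤ N) (γ D : ℝ) (hγ : γ ∈ Set.Ioo (0 : ℝ) 1) (hD : 0 ≤ D)
    (A1 A2 A3 : ℝ) (h1 : 0 < A1) (h2 : A2 < 0) (h3 : 0 < A3)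
    (hdisc : 3 * A1 * A3 ≤ A2 ^ 2)
    (t : ℕ → ℝ) (htpos : ∀ k : ℕ, 1 ≤ k → k ≤ N + 1 → 0 < t k)
    (htmono : ∀ k l : ℕ, 1 ≤ k → k < l → l ≤ N + 1 → t k < t l)
    (htau : t (N + 1) ≤ (-A2 - Real.sqrt (A2 ^ 2 - 3 * A1 * A3)) / A1) :
    let E : ℝ → ℝ := fun s => (A1 * s ^ 2 + A2 * s + A3) / s ^ 3
    let J : ℕ → ℝ := fun k =>
      if k = 1 then E (t 1) else E (t k) + D * ∑ i ∈ Finset.Icc k N, γ ^ (i - k)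
    (Finset.Icc 1 (N + 1)).inf' (Finset.nonempty_Icc.mpr (by omega)) J =
      min (J 1) (J (N + 1)) := by
  intro E J
  have hE : ∀ k : ℕ, 1 ≤ k → k ≤ N → E (t (N + 1)) ≤ E (t k) := by
    intro k hk hkN
    have hs := htpos k hk (by omega)
    have ht := htpos (N + 1) (by omega) le_rfl
    have hst := htmono k (N + 1) hk (by omega) le_rfl
    rw [le_div_iff₀ h1] at htau
    have hr0 := Real.sqrt_nonneg (A2 ^ 2 - 3 * A1 * A3)
    have hr2 := Real.sq_sqrt (show 0 ≤ A2 ^ 2 - 3 * A1 * A3 by linarith)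
    simp only [E]
    generalize Real.sqrt (A2 ^ 2 - 3 * A1 * A3) = r at *
    generalize t (N + 1) = y at *
    generalize t k = x at *
    have hq : 0 ≤ A1 * y ^ 2 + 2 * A2 * y + 3 * A3 := by
      have h : 0 ≤ A1 * (A1 * y ^ 2 + 2 * A2 * y + 3 * A3) := by
        have : r ^ 2 ≤ (-(A2 + y * A1)) ^ 2 := by
          apply pow_le_pow_left₀ hr0
          linarith
        nlinarith
      exact nonneg_of_mul_nonneg_right h h1
    have hl : 0 ≤ A2 * y + 3 * A3 := by
      have : 0 ≤ y * (-A2 - y * A1) := mul_nonneg ht.le (by linarith)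
      nlinarith
    have hd : 0 ≤ y - x := by linarith
    have hB : 0 ≤ x ^ 2 * (A1 * y ^ 2 + 2 * A2 * y + 3 * A3)
        + x * (y - x) * (A2 * y + 3 * A3) + A3 * (y - x) ^ 2 := by positivity
    rw [div_le_div_iff₀ (by positivity) (by positivity)]
    have := mul_nonneg hd hB
    nlinarith
  have hJN : J (N + 1) = E (t (N + 1)) := by
    have : N ≠ 0 := by omega
    simp [J, this]
  apply le_antisymm
  · apply le_min
    · exact Finset.inf'_le _ (by simp)
    · exact Finset.inf'_le _ (by simp)
  · apply Finset.le_inf'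
    intro k hk
    rw [Finset.mem_Icc] at hk
    by_cases hk1 : k = 1
    · subst hk1
      exact min_le_left _ _
    · by_cases hkN : k = N + 1
      · subst hkN
        exact min_le_right _ _
      · refine (min_le_right _ _).trans ?_
        rw [hJN]
        have h := hE k hk.1 (by omega)
        have hγ0 := hγ.1.le
        have hS : 0 ≤ D * ∑ i ∈ Finset.Icc k N, γ ^ (i - k) :=
          mul_nonneg hD (Finset.sum_nonneg fun i _ => pow_nonneg hγ0 _)
        simp only [J, if_neg hk1]
        linarith
end
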